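/- Let a > 0 and let A:[0,∞) → [0,∞) be continuous with A(0) = 0 and A(t) ≤ a + t^{1/2}·A(t)² for all t ≥ 0. Then A(t) ≤ 2a for all t with 0 ≤ t ≤ (4a)^{−2}. -/

import Mathlib

noncomputable section

open MeasureTheory Real Set Filter Metric
open scoped FourierTransform ENNReal NNReal Topology ProbabilityTheory

/-- Physical/frequency space `ℝ³`. -/
abbrev V3 := EuclideanSpace ℝ (Fin 3)

/-- The Fourier multiplier with symbol `m`. -/
def fmul (m : V3 → ℂ) (f : V3 → ℂ) : V3 → ℂ :=
  FourierTransformInv.fourierInv fun ξ => m ξ * FourierTransform.fourier f ξ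

/-- The Japanese bracket `⟨∇⟩^s`, i.e. the Fourier multiplier with symbol `(1+|ξ|²)^(s/2)`. -/
def jap (s : ℝ) (f : V3 → ℂ) : V3 → ℂ :=
  fmul (fun ξ => (((1 + ‖ξ‖ ^ 2) ^ (s / 2) : ℝ) : ℂ)) f

/-- The (extended-real-valued) Sobolev norm `‖f‖_{H^s} = ‖⟨∇⟩^s f‖_{L²}`. -/
def HsNorm (s : ℝ) (f : V3 → ℂ) : ℝ≥0∞ := eLpNorm (jap s f) 2 volume

/-- Partial derivative in the `i`-th coordinate direction. -/
def pd (i : Fin 3) (f : V3 → ℂ) : V3 → ℂ :=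
  fun x => fderiv ℝ f x (EuclideanSpace.single i (1 : ℝ))

/-- `∇f·∇g`. -/
def gradDot (f g : V3 → ℂ) : V3 → ℂ := fun x => ∑ i : Fin 3, pd i f x * pd i g x

/-- The symbol `sin(t|ξ|)/|ξ|`. -/
def sinDiv (t : ℝ) (ξ : V3) : ℂ := ((Real.sin (t * ‖ξ‖) / ‖ξ‖ : ℝ) : ℂ)

/-- Free wave evolution `W(t)(f₀,f₁)`. -/
def waveEvol (t : ℝ) (f₀ f₁ : V3 → ℂ) : V3 → ℂ :=
  fun x => fmul (fun ξ => ((Real.cos (t * ‖ξ‖) : ℝ) : ℂ)) f₀ x + fmul (sinDiv t) f₁ x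

/-- Duhamel integral `Duh[F](t) = ∫₀ᵗ sin((t−s)|∇|)|∇|⁻¹ F(s) ds`. -/
def Duh (F : ℝ → V3 → ℂ) (t : ℝ) : V3 → ℂ :=
  fun x => ∫ τ in (0:ℝ)..t, fmul (sinDiv (t - τ)) (F τ) x

/-- Time derivative of a space-time function. -/
def dt (u : ℝ → V3 → ℂ) : ℝ → V3 → ℂ := fun t x => deriv (fun τ => u τ x) t

/-- `χ` is an admissible Littlewood–Paley cutoff: smooth, `≡1` on `B(0,1)`, `≡0` outside
`B(0,2)`. -/
def IsLPCutoff (χ : V3 → ℝ) : Prop :=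
  ContDiff ℝ (⊤ : ℕ∞) χ ∧ (∀ ξ : V3, ‖ξ‖ < 1 → χ ξ = 1) ∧ (∀ ξ : V3, 2 ≤ ‖ξ‖ → χ ξ = 0)

/-- The Littlewood–Paley symbol `ψ_M` with `M = 2^j`: `ψ_1 = χ` and
`ψ_M(ξ) = χ(ξ/M) − χ(2ξ/M)` for `M ≥ 2`. -/
def lpSymb (χ : V3 → ℝ) : ℕ → V3 → ℝ
  | 0 => χ
  | (j+1) => fun ξ => χ ((((2:ℝ)^(j+1))⁻¹) • ξ) - χ (((2:ℝ) * ((2:ℝ)^(j+1))⁻¹) • ξ)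

/-- Littlewood–Paley projection `P_M` with `M = 2^j`. -/
def PM (χ : V3 → ℝ) (j : ℕ) (f : V3 → ℂ) : V3 → ℂ :=
  fmul (fun ξ => (lpSymb χ j ξ : ℂ)) f

/-- The point of `ℝ³` with integer coordinates `k`. -/
def ivec (k : Fin 3 → ℤ) : V3 := (WithLp.equiv 2 (Fin 3 → ℝ)).symm fun i => (k i : ℝ)

/-- Re-centered Littlewood–Paley projection `P_{M;k}` with `M = 2^j`. -/
def PMk (χ : V3 → ℝ) (j : ℕ) (k : Fin 3 → ℤ) (f : V3 → ℂ) : V3 → ℂ :=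
  fmul (fun ξ => (lpSymb χ j (ξ - ivec k) : ℂ)) f

/-- Fattened projection `P̃_N = Σ_{N/4 ≤ M ≤ 4N} P_M`, `N = 2^n`. -/
def Ptilde (χ : V3 → ℝ) (n : ℕ) (f : V3 → ℂ) : V3 → ℂ :=
  fun x => ∑ j ∈ Finset.range (n+3), if n ≤ j + 2 then PM χ j f x else 0

/-- Projection `P_{>A}` onto dyadic frequencies `M = 2^j > A`. -/
def Pgt (χ : V3 → ℝ) (A : ℝ) (f : V3 → ℂ) : V3 → ℂ :=
  fun x => ∑' j : ℕ, if A < (2:ℝ)^j then PM χ j f x else 0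

/-- `φ` is an admissible Wiener cutoff: smooth, compactly supported, `[0,1]`-valued, with
`Σ_k φ(·−k) ≡ 1`. -/
def IsWienerCutoff (φ : V3 → ℝ) : Prop :=
  ContDiff ℝ (⊤ : ℕ∞) φ ∧ HasCompactSupport φ ∧ (∀ ξ, φ ξ ∈ Icc (0:ℝ) 1) ∧
    ∀ ξ : V3, ∑' k : Fin 3 → ℤ, φ (ξ - ivec k) = 1

/-- The cube projection `P_k` of the Wiener decomposition. -/
def Pk (φ : V3 → ℝ) (k : Fin 3 → ℤ) (f : V3 → ℂ) : V3 → ℂ :=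
  fmul (fun ξ => (φ (ξ - ivec k) : ℂ)) f

/-- Wiener randomization `f^ω = Σ_k g_k(ω) P_k f`. -/
def randz (φ : V3 → ℝ) {Ω : Type*} (g : (Fin 3 → ℤ) → Ω → ℂ) (ω : Ω) (f : V3 → ℂ) :
    V3 → ℂ :=
  fun x => ∑' k : Fin 3 → ℤ, g k ω * Pk φ k f x

/-- Frequency-annulus randomized piece `Q_N f^ω`, `N = 2^n`. -/
def QN (φ : V3 → ℝ) {Ω : Type*} (g : (Fin 3 → ℤ) → Ω → ℂ) (n : ℕ) (ω : Ω) (f : V3 → ℂ) :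
    V3 → ℂ :=
  if n = 0 then fun x => g 0 ω * Pk φ 0 f x
  else fun x => ∑' k : Fin 3 → ℤ,
    if (2:ℝ)^n / 2 ≤ ‖ivec k‖ ∧ ‖ivec k‖ < (2:ℝ)^n then g k ω * Pk φ k f x else 0

/-- The standard complex Gaussian measure on `ℂ`. -/
def stdCGaussian : Measure ℂ :=
  Measure.map (fun p : ℝ × ℝ => (p.1 : ℂ) + (p.2 : ℂ) * Complex.I)
    ((ProbabilityTheory.gaussianReal 0 (1/2)).prod (ProbabilityTheory.gaussianReal 0 (1/2)))

/-- `g` is a family of independent standard complex Gaussians. -/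
def IsStdGaussianFamily {Ω : Type*} [MeasureSpace Ω] (g : (Fin 3 → ℤ) → Ω → ℂ) : Prop :=
  (∀ k, Measurable (g k)) ∧ (∀ k, Measure.map (g k) ℙ = stdCGaussian) ∧
    ProbabilityTheory.iIndepFun g ℙ

/-- `sup_{t∈[0,T]} ‖u(t)‖_{L²_x}`, i.e. the `C⁰_t L²_x`-norm. -/
def supL2t (T : ℝ) (u : ℝ → V3 → ℂ) : ℝ≥0∞ := ⨆ t ∈ Icc (0:ℝ) T, eLpNorm (u t) 2 volume

/-- `sup_{t∈[0,T]} ‖u(t)‖_{H^s_x}`. -/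
def supHs (s T : ℝ) (u : ℝ → V3 → ℂ) : ℝ≥0∞ := ⨆ t ∈ Icc (0:ℝ) T, HsNorm s (u t)

/-- Mixed norm `‖u‖_{L^q_t L^p_x([0,T]×ℝ³)}`. -/
def mixed {E : Type*} [NormedAddCommGroup E] (q p : ℝ≥0∞) (T : ℝ) (u : ℝ → V3 → E) : ℝ≥0∞ :=
  eLpNorm (fun t => (eLpNorm (u t) p volume).toReal) q (volume.restrict (Icc (0:ℝ) T))

/-- Mixed norm `‖u‖_{L^q_t L^p_x(ℝ×ℝ³)}`. -/
def mixedGlobal {E : Type*} [NormedAddCommGroup E] (q p : ℝ≥0∞) (u : ℝ → V3 → E) : ℝ≥0∞ :=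
  eLpNorm (fun t => (eLpNorm (u t) p volume).toReal) q volume

/-- Weight `c_{N,D}(M)` with `M = 2^j`. -/
def cN (N D : ℝ) (j : ℕ) : ℝ := max (N / 2^j) ((2:ℝ)^j / N) ^ D

/-- Weight `c_{≤N,D}(M)` with `M = 2^j`. -/
def cLe (N D : ℝ) (j : ℕ) : ℝ := max 1 ((2:ℝ)^j / N) ^ D

/-- The norm of the space `X_{N,D}([0,T])`. -/
def XN (χ : V3 → ℝ) (N D T : ℝ) (u : ℝ → V3 → ℂ) : ℝ≥0∞ :=
  ∑' j : ℕ, ENNReal.ofReal (cN N D j) * supL2t T fun t => PM χ j (u t)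

/-- The norm of the space `X_{≤N,D}([0,T])`. -/
def XLe (χ : V3 → ℝ) (N D T : ℝ) (u : ℝ → V3 → ℂ) : ℝ≥0∞ :=
  ∑' j : ℕ, ENNReal.ofReal (cLe N D j) * supL2t T fun t => PM χ j (u t)

/-- The norm of the space `S_{N,D}([0,T])`. -/
def SN (χ : V3 → ℝ) (N D T : ℝ) (u : ℝ → V3 → ℂ) : ℝ≥0∞ :=
  ∑' j : ℕ, ENNReal.ofReal (cN N D j) * mixed 2 ∞ T fun t => PM χ j (u t)

/-- The norm of the space `S_{≤N,D}([0,T])`. -/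
def SLe (χ : V3 → ℝ) (N D T : ℝ) (u : ℝ → V3 → ℂ) : ℝ≥0∞ :=
  ∑' j : ℕ, ENNReal.ofReal (cLe N D j) * mixed 2 ∞ T fun t => PM χ j (u t)

/-- The norm of the space `S^{q,p}_{N,D}([0,T])`. -/
def Sqp (χ : V3 → ℝ) (N D : ℝ) (q p : ℝ≥0∞) (T : ℝ) (u : ℝ → V3 → ℂ) : ℝ≥0∞ :=
  ∑' j : ℕ, ENNReal.ofReal (cN N D j) * mixed q p T fun t => PM χ j (u t)

/-- The `Y_N([0,T])`-norm (with parameters `ν, σ, η, D`). -/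
def YN (χ : V3 → ℝ) (ν σ η D N T : ℝ) (u : ℝ → V3 → ℂ) : ℝ≥0∞ :=
  XN χ N η T (fun t => jap ν (u t)) + XLe χ N D T (fun t => jap ν (u t)) +
  XN χ N η T (fun t => jap (ν-1) (dt u t)) + XLe χ N D T (fun t => jap (ν-1) (dt u t)) +
  SN χ N η T (fun t => jap σ (u t)) + SLe χ N D T (fun t => jap σ (u t))

/-- The re-centered Besov norm `‖f‖_{B^{ρ,γ}_{k,D}}` (with `N` the size of `‖k‖₂`). -/
def Bnorm (χ : V3 → ℝ) (k : Fin 3 → ℤ) (ρ γ D N : ℝ) (f : V3 → ℂ) : ℝ≥0∞ :=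
  ∑' j : ℕ, ENNReal.ofReal (((2:ℝ)^j : ℝ) ^ ρ * max 1 ((2:ℝ)^j / N ^ γ) ^ D) *
    eLpNorm (PMk χ j k f) 2 volume

/-- `sup_{t∈[0,T]}` of the `B^{ρ,γ}_{k,D}`-norm. -/
def supB (χ : V3 → ℝ) (k : Fin 3 → ℤ) (ρ γ D N T : ℝ) (u : ℝ → V3 → ℂ) : ℝ≥0∞ :=
  ⨆ t ∈ Icc (0:ℝ) T, Bnorm χ k ρ γ D N (u t)

/-- Low-high paraproduct `I_{LH}(v,w) = Σ_{L≪K} Duh[∇P_L v · ∇P_K w]`. -/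
def Ilh (χ : V3 → ℝ) (v w : ℝ → V3 → ℂ) : ℝ → V3 → ℂ := fun t x =>
  ∑' p : ℕ × ℕ, if p.1 + 3 ≤ p.2 then
    Duh (fun s => gradDot (PM χ p.1 (v s)) (PM χ p.2 (w s))) t x else 0

/-- High-low paraproduct `I_{HL}(v,w) = Σ_{L≫K} Duh[∇P_L v · ∇P_K w]`. -/
def Ihl (χ : V3 → ℝ) (v w : ℝ → V3 → ℂ) : ℝ → V3 → ℂ := fun t x =>
  ∑' p : ℕ × ℕ, if p.2 + 3 ≤ p.1 then
    Duh (fun s => gradDot (PM χ p.1 (v s)) (PM χ p.2 (w s))) t x else 0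

/-- High-high paraproduct `I_{HH}(v,w) = Σ_{L∼K} Duh[∇P_L v · ∇P_K w]`. -/
def Ihh (χ : V3 → ℝ) (v w : ℝ → V3 → ℂ) : ℝ → V3 → ℂ := fun t x =>
  ∑' p : ℕ × ℕ, if p.1 ≤ p.2 + 2 ∧ p.2 ≤ p.1 + 2 then
    Duh (fun s => gradDot (PM χ p.1 (v s)) (PM χ p.2 (w s))) t x else 0

/-- `u ∈ C⁰_t L²_x([0,T]×ℝ³)`: each `u(t)` is in `L²` and `t ↦ u(t)` is `L²`-continuous. -/
def ContL2 (T : ℝ) (u : ℝ → V3 → ℂ) : Prop :=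
  (∀ t ∈ Icc (0:ℝ) T, MemLp (u t) 2 volume) ∧
    ∀ t ∈ Icc (0:ℝ) T, Tendsto (fun τ => eLpNorm (fun x => u τ x - u t x) 2 volume)
      (𝓝[Icc (0:ℝ) T] t) (𝓝 0)

/-- `u ∈ C⁰_t H^s_x([0,T]×ℝ³)`. -/
def ContHs (s T : ℝ) (u : ℝ → V3 → ℂ) : Prop :=
  (∀ t ∈ Icc (0:ℝ) T, MemLp (jap s (u t)) 2 volume) ∧
    ∀ t ∈ Icc (0:ℝ) T, Tendsto (fun τ => HsNorm s (fun x => u τ x - u t x))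
      (𝓝[Icc (0:ℝ) T] t) (𝓝 0)

/-- A simple function with respect to the σ-algebra `𝔊`. -/
def SimpleFuncOn {Ω E : Type*} (𝔊 : MeasurableSpace Ω) (v : Ω → E) : Prop :=
  (Set.range v).Finite ∧ ∀ e : E, MeasurableSet[𝔊] (v ⁻¹' {e})

/-- Strong `𝔊`-measurability of `v : Ω → E` with respect to the extended distance `d` on `E`:
`v` is a pointwise limit (in `d`) of `𝔊`-simple functions. -/
def StronglyMeasIn {Ω E : Type*} (𝔊 : MeasurableSpace Ω) (d : E → E → ℝ≥0∞) (v : Ω → E) :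
    Prop :=
  ∃ s : ℕ → Ω → E, (∀ n, SimpleFuncOn 𝔊 (s n)) ∧
    ∀ ω, Tendsto (fun n => d (s n ω) (v ω)) atTop (𝓝 0)


/-- Membership in `L²_t L^∞_x([0,T]×ℝ³)`. -/
def MemL2Linf (T : ℝ) (u : ℝ → V3 → ℂ) : Prop :=
  AEStronglyMeasurable (Function.uncurry u) ((volume.restrict (Icc (0:ℝ) T)).prod volume) ∧
    mixed 2 ∞ T u ≠ ∞

/-- If `A : [0,∞) → [0,∞)` is continuous with `A(0) = 0` and
`A(t) ≤ a + t^{1/2}·A(t)²` for all `t ≥ 0`, then `A(t) ≤ 2a` for `0 ≤ t ≤ (4a)⁻²`. -/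
theorem bootstrap_bound (a : ℝ) (ha : 0 < a) (A : ℝ → ℝ)
    (hA_nonneg : ∀ t : ℝ, 0 ≤ t → 0 ≤ A t)
    (hA_cont : ContinuousOn A (Ici (0:ℝ)))
    (hA0 : A 0 = 0)
    (hA_ineq : ∀ t : ℝ, 0 ≤ t → A t ≤ a + Real.sqrt t * (A t) ^ 2) :
    ∀ t : ℝ, 0 ≤ t → t ≤ ((4 * a) ^ 2)⁻¹ → A t ≤ 2 * a := by
  intro t ht htT
  by_contra! hlt
  have hc : ContinuousOn A (Icc 0 t) := hA_cont.mono Icc_subset_Ici_self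
  obtain ⟨s, hs, hAs⟩ := intermediate_value_Icc ht hc
    (show 2 * a ∈ Icc (A 0) (A t) from ⟨by rw [hA0]; positivity, hlt.le⟩)
  have hst : s < t := lt_of_le_of_ne hs.2 (by rintro rfl; linarith)
  have hsq : Real.sqrt s < (4 * a)⁻¹ := by
    rw [Real.sqrt_lt' (by positivity), inv_pow]
    exact hst.trans_le htT
  have h1 := hA_ineq s hs.1
  rw [hAs] at h1
  have h2 : Real.sqrt s * (4 * a) < 1 := by
    have := mul_lt_mul_of_pos_right hsq (show 0 < 4 * a by positivity)
    rwa [inv_mul_cancel₀ (by positivity)] at this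
  nlinarith [mul_lt_mul_of_pos_right h2 ha]

end
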